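/- Let p be a prime and let G be a non-abelian finite p-group with commutator subgroup G' of order p^k and d = d(G). Then |M(G)| · p^k ≤ |M(G/G')| · p^{kd}, where M(G) and M(G/G') denote the Schur multipliers of G and of its abelianization G/G', each computed via Hopf's formula from a free presentation. -/

import Mathlib

/-- The minimal number of elements required to generate a group `G`. -/
noncomputable def minGens (G : Type*) [Group G] : ℕ :=
  sInf {n | ∃ S : Finset G, S.card = n ∧ Subgroup.closure (S : Set G) = ⊤}

/-- The cardinality of the Hopf quotient `(R ∩ [F,F]) / [R,F]` associated to a
presentation `π : F → G` with kernel `R = ker π`. -/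
noncomputable def hopfCard {F G : Type*} [Group F] [Group G] (π : F →* G) : ℕ :=
  Nat.card ((π.ker ⊓ commutator F : Subgroup F) ⧸
    (⁅π.ker, (⊤ : Subgroup F)⁆.subgroupOf (π.ker ⊓ commutator F)))

/-- The order of the Schur multiplier `M(G)`, computed by Hopf's formula from the
canonical free presentation `FreeGroup G → G`. -/
noncomputable def schurCard (G : Type*) [Group G] : ℕ :=
  hopfCard (FreeGroup.lift (id : G → G))

section Aux

open scoped commutatorElement

theorem aux_card_closure {Q : Type*} [Group Q] {p : ℕ} [hp : Fact p.Prime] (X : Finset Q)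
    (hc : ∀ x ∈ X, x ∈ Subgroup.center Q) (hx : ∀ x ∈ X, x ^ p = 1) :
    Finite (Subgroup.closure (X : Set Q)) ∧
      Nat.card (Subgroup.closure (X : Set Q)) ≤ p ^ X.card := by
  classical
  induction X using Finset.induction_on with
  | empty =>
    rw [Finset.coe_empty, Subgroup.closure_empty]
    exact ⟨inferInstance, by simp⟩
  | insert a X ha ih =>
    obtain ⟨ihf, ih'⟩ := ih (fun x h => hc x (Finset.mem_insert_of_mem h))
      (fun x h => hx x (Finset.mem_insert_of_mem h))
    have hC : Subgroup.closure (X : Set Q) ≤ Subgroup.center Q :=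
      (Subgroup.closure_le _).2 fun x h => hc x (Finset.mem_insert_of_mem h)
    have hn : (Subgroup.closure (X : Set Q)).Normal :=
      ⟨fun n hn g => by rw [← (Subgroup.mem_center_iff.1 (hC hn) g).symm]; simpa using hn⟩
    rw [Finset.card_insert_of_notMem ha, Finset.coe_insert, Set.insert_eq, Subgroup.closure_union,
      ← Subgroup.zpowers_eq_closure, pow_succ']
    have h1 : Nat.card (Subgroup.zpowers a) ≤ p := by
      rw [Nat.card_zpowers]
      exact Nat.le_of_dvd hp.out.pos (orderOf_dvd_of_pow_eq_one (hx a (by simp)))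
    have h2 := Set.natCard_mul_le (s := (Subgroup.zpowers a : Set Q))
      (t := (Subgroup.closure (X : Set Q) : Set Q))
    rw [← Subgroup.mul_normal] at h2
    have hf1 : (Subgroup.zpowers a : Set Q).Finite := by
      have : IsOfFinOrder a :=
        isOfFinOrder_iff_pow_eq_one.2 ⟨p, hp.out.pos, hx a (by simp)⟩
      exact this.finite_zpowers
    have hf := hf1.mul (t := (Subgroup.closure (X : Set Q) : Set Q)) ihf
    rw [← Subgroup.mul_normal] at hf
    refine ⟨hf, ?_⟩
    exact h2.trans (Nat.mul_le_mul h1 ih')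

theorem aux_comm_pow {Q : Type*} [Group Q] (s x : Q) (h : ⁅s, x⁆ ∈ Subgroup.center Q) (n : ℕ) :
    ⁅s ^ n, x⁆ = ⁅s, x⁆ ^ n := by
  induction n with
  | zero => simp
  | succ n ih =>
    rw [pow_succ, commutatorElement_mul_left_eq_conj_mul, ih, Subgroup.mem_center_iff.1 h,
      mul_inv_cancel_right, pow_succ']

theorem aux_normal_of_central {Q : Type*} [Group Q] (C : Subgroup Q)
    (hC : C ≤ Subgroup.center Q) : C.Normal :=
  ⟨fun n hn g => by rw [Subgroup.mem_center_iff.1 (hC hn) g]; simpa using hn⟩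

theorem aux_comm_card {Q : Type*} [Group Q] {p : ℕ} [hp : Fact p.Prime] (X : Finset Q)
    (R S : Subgroup Q) (s : Q) (hR : R ≤ Subgroup.center Q) (hS : S ≤ R ⊔ Subgroup.zpowers s)
    (hsp : s ^ p ∈ R) (hs : ∀ q, ⁅s, q⁆ ∈ Subgroup.center Q)
    (hX : R ⊔ Subgroup.closure (X : Set Q) = ⊤) :
    Nat.card (⁅S, (⊤ : Subgroup Q)⁆ : Subgroup Q) ≤ p ^ X.card := by
  classical
  set Y : Finset Q := X.image (fun x => ⁅s, x⁆) with hY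
  have hYc : ∀ y ∈ Y, y ∈ Subgroup.center Q := by
    intro y hy
    obtain ⟨x, -, rfl⟩ := Finset.mem_image.1 hy
    exact hs x
  have hYp : ∀ y ∈ Y, y ^ p = 1 := by
    intro y hy
    obtain ⟨x, -, rfl⟩ := Finset.mem_image.1 hy
    rw [← aux_comm_pow s x (hs x), commutatorElement_eq_one_iff_mul_comm]
    exact (Subgroup.mem_center_iff.1 (hR hsp) x).symm
  obtain ⟨hfin, hcard⟩ := aux_card_closure (p := p) Y hYc hYp
  set C := Subgroup.closure (Y : Set Q) with hCdef
  have hC : C ≤ Subgroup.center Q := (Subgroup.closure_le _).2 hYc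
  have hCn : C.Normal := aux_normal_of_central C hC
  have key : ∀ a b : Q, ⁅a, b⁆ ∈ C ↔ (a : Q ⧸ C) * b = b * a := by
    intro a b
    rw [← commutatorElement_eq_one_iff_mul_comm, ← QuotientGroup.eq_one_iff]
    exact Iff.rfl
  have h1 : ∀ q, ⁅s, q⁆ ∈ C := by
    have : (⊤ : Subgroup Q) ≤ (Subgroup.centralizer {(s : Q ⧸ C)}).comap (QuotientGroup.mk' C) := by
      rw [← hX, sup_le_iff, Subgroup.closure_le]
      constructor
      · intro r hr
        simp only [Subgroup.mem_comap, Subgroup.mem_centralizer_singleton_iff]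
        have := Subgroup.mem_center_iff.1 (hR hr) s
        exact (congrArg (QuotientGroup.mk' C) this.symm)
      · intro x hx
        simp only [SetLike.mem_coe, Subgroup.mem_comap, Subgroup.mem_centralizer_singleton_iff]
        have : ⁅s, x⁆ ∈ C := Subgroup.subset_closure (Finset.mem_image_of_mem _ hx)
        exact ((key _ _).1 this).symm
    intro q
    have := this (Subgroup.mem_top q)
    simp only [Subgroup.mem_comap, Subgroup.mem_centralizer_singleton_iff] at this
    exact (key _ _).2 this.symm
  have h2 : S ≤ (Subgroup.center (Q ⧸ C)).comap (QuotientGroup.mk' C) := by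
    refine hS.trans ?_
    rw [sup_le_iff, Subgroup.zpowers_le]
    constructor
    · intro r hr
      rw [Subgroup.mem_comap, Subgroup.mem_center_iff]
      intro g
      obtain ⟨g, rfl⟩ := QuotientGroup.mk'_surjective C g
      exact congrArg (QuotientGroup.mk' C) (Subgroup.mem_center_iff.1 (hR hr) g)
    · rw [Subgroup.mem_comap, Subgroup.mem_center_iff]
      intro g
      obtain ⟨g, rfl⟩ := QuotientGroup.mk'_surjective C g
      exact ((key _ _).1 (h1 g)).symm
  have h3 : ⁅S, (⊤ : Subgroup Q)⁆ ≤ C := by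
    rw [Subgroup.commutator_le]
    intro a ha b _
    exact (key _ _).2 (Subgroup.mem_center_iff.1 (h2 ha) b).symm
  calc Nat.card (⁅S, (⊤ : Subgroup Q)⁆ : Subgroup Q) ≤ Nat.card C := Subgroup.card_le_of_le h3
    _ ≤ p ^ Y.card := hcard
    _ ≤ p ^ X.card := Nat.pow_le_pow_right hp.out.pos Finset.card_image_le

theorem aux_step {F : Type*} [Group F] {p : ℕ} [hp : Fact p.Prime] (X : Finset F)
    (R S : Subgroup F) [R.Normal] [S.Normal] (s : F) (hRS : R ≤ S)
    (hSs : S ≤ R ⊔ Subgroup.zpowers s) (hsS : s ∈ S) (hsp : s ^ p ∈ R)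
    (hSR : ⁅S, (⊤ : Subgroup F)⁆ ≤ R) (hidx : R.relIndex S = p)
    (hSD : S ≤ R ⊔ commutator F) (hX : R ⊔ Subgroup.closure (X : Set F) = ⊤) :
    (⁅R, (⊤ : Subgroup F)⁆).relIndex (R ⊓ commutator F) * p ≤
      (⁅S, (⊤ : Subgroup F)⁆).relIndex (S ⊓ commutator F) * p ^ X.card := by
  classical
  set N := ⁅R, (⊤ : Subgroup F)⁆ with hN
  set T := ⁅S, (⊤ : Subgroup F)⁆ with hT
  have hNT : N ≤ T := Subgroup.commutator_mono hRS le_rfl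
  have hTF : T ≤ commutator F := Subgroup.commutator_mono le_top le_rfl
  have hNR : N ≤ R := Subgroup.commutator_le_left _ _
  have hTS : T ≤ S := Subgroup.commutator_le_left _ _
  have e1 := Subgroup.relIndex_mul_relIndex N (R ⊓ commutator F) (S ⊓ commutator F)
    (le_inf hNR (hNT.trans hTF)) (inf_le_inf_right _ hRS)
  have e2 := Subgroup.relIndex_mul_relIndex N T (S ⊓ commutator F) hNT (le_inf hTS hTF)
  have e3 : (R ⊓ commutator F).relIndex (S ⊓ commutator F) = p := by
    have : R ⊓ commutator F = R ⊓ (S ⊓ commutator F) := by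
      rw [← inf_assoc, inf_eq_left.2 hRS]
    have hmod : R ⊔ S ⊓ commutator F = S := by
      refine le_antisymm (sup_le hRS inf_le_left) ?_
      intro x hx
      obtain ⟨r, hr, c, hc, rfl⟩ := Subgroup.mem_sup_of_normal_left.1 (hSD hx)
      exact Subgroup.mul_mem_sup hr ⟨(Subgroup.mul_mem_cancel_left S (hRS hr)).1 hx, hc⟩
    rw [this, Subgroup.inf_relIndex_right, ← Subgroup.relIndex_sup_left, hmod, hidx]
  have e4 : N.relIndex T ≤ p ^ X.card := by
    have hk := Subgroup.relIndex_ker T (QuotientGroup.mk' N)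
    rw [QuotientGroup.ker_mk'] at hk
    have hsurj := QuotientGroup.mk'_surjective N
    have hcen : R.map (QuotientGroup.mk' N) ≤ Subgroup.center (F ⧸ N) := by
      rintro _ ⟨r, hr, rfl⟩
      rw [Subgroup.mem_center_iff]
      intro g
      obtain ⟨g, rfl⟩ := hsurj g
      symm
      rw [← commutatorElement_eq_one_iff_mul_comm, ← map_commutatorElement]
      exact (QuotientGroup.eq_one_iff _).2 (Subgroup.commutator_mem_commutator hr trivial)
    rw [hk, hT, Subgroup.map_commutator, Subgroup.map_top_of_surjective _ hsurj]
    refine (aux_comm_card (p := p) (X.image (QuotientGroup.mk' N)) (R.map (QuotientGroup.mk' N)) _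
      (QuotientGroup.mk' N s) hcen ?_ ?_ ?_ ?_).trans
      (Nat.pow_le_pow_right hp.out.pos Finset.card_image_le)
    · have := Subgroup.map_mono (f := QuotientGroup.mk' N) hSs
      rwa [Subgroup.map_sup, MonoidHom.map_zpowers] at this
    · rw [← map_pow]
      exact Subgroup.mem_map_of_mem _ hsp
    · intro q
      obtain ⟨q, rfl⟩ := hsurj q
      rw [← map_commutatorElement]
      exact hcen (Subgroup.mem_map_of_mem _
        (hSR (Subgroup.commutator_mem_commutator hsS trivial)))
    · rw [Finset.coe_image, ← MonoidHom.map_closure, ← Subgroup.map_sup, hX,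
        Subgroup.map_top_of_surjective _ hsurj]
  rw [e3] at e1
  rw [e1, ← e2, mul_comm]
  exact Nat.mul_le_mul_left _ e4

theorem aux_exists_central {H : Type*} [Group H] [Finite H] {p : ℕ} [hp : Fact p.Prime]
    (hH : IsPGroup p H) (N : Subgroup H) [N.Normal] (hN : N ≠ ⊥) :
    ∃ z ∈ N, z ∈ Subgroup.center H ∧ orderOf z = p := by
  have hdvd : p ∣ Nat.card N := by
    rcases (hH.to_subgroup N).card_eq_or_dvd with h | h
    · exact absurd ((Subgroup.card_eq_one).1 h) hN
    · exact h
  have hH' : IsPGroup p (ConjAct H) := hH.of_equiv ConjAct.toConjAct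
  obtain ⟨b, hb, hb1⟩ := hH'.exists_fixed_point_of_prime_dvd_card_of_fixed_point N hdvd
    (a := 1) (by intro g; simp)
  have hbc : (b : H) ∈ Subgroup.center H := by
    rw [Subgroup.mem_center_iff]
    intro g
    have := congrArg Subtype.val (hb (ConjAct.toConjAct g))
    rw [ConjAct.Subgroup.val_conj_smul, ConjAct.toConjAct_smul] at this
    rwa [mul_inv_eq_iff_eq_mul] at this
  have hd2 : p ∣ Nat.card (N ⊓ Subgroup.center H : Subgroup H) := by
    rcases (hH.to_subgroup (N ⊓ Subgroup.center H)).card_eq_or_dvd with h | h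
    · exfalso
      have h0 := (Subgroup.card_eq_one).1 h
      have : (b : H) ∈ N ⊓ Subgroup.center H := ⟨b.2, hbc⟩
      rw [h0, Subgroup.mem_bot] at this
      exact hb1 (Subtype.ext this.symm)
    · exact h
  obtain ⟨x, hx⟩ := exists_prime_orderOf_dvd_card' p hd2
  exact ⟨x, x.2.1, x.2.2, by simpa using hx⟩

theorem aux_induct {F : Type*} [Group F] {p : ℕ} [hp : Fact p.Prime] (X : Finset F) (k : ℕ) :
    ∀ (R : Subgroup F) [R.Normal] [Finite (F ⧸ R)], IsPGroup p (F ⧸ R) →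
    R ⊔ Subgroup.closure (X : Set F) = ⊤ →
    R.relIndex (R ⊔ commutator F) = p ^ k →
    (⁅R, (⊤ : Subgroup F)⁆).relIndex (R ⊓ commutator F) * p ^ k ≤
      (⁅R ⊔ commutator F, (⊤ : Subgroup F)⁆).relIndex ((R ⊔ commutator F) ⊓ commutator F)
        * p ^ (k * X.card) := by
  induction k with
  | zero =>
    intro R _ _ hP hX hi
    rw [pow_zero, Subgroup.relIndex_eq_one] at hi
    have : R ⊔ commutator F = R := le_antisymm hi le_sup_left
    rw [this]
    simp
  | succ k ih =>
    intro R _ _ hP hX hi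
    set π := QuotientGroup.mk' R with hπ
    have hsurj : Function.Surjective π := QuotientGroup.mk'_surjective R
    have hker : π.ker = R := QuotientGroup.ker_mk' R
    have hne : (commutator F).map π ≠ ⊥ := by
      intro h
      rw [Subgroup.relIndex_sup_left] at hi
      have hk := Subgroup.relIndex_ker (commutator F) π
      rw [hker, h, hi] at hk
      simp only [Subgroup.card_bot] at hk
      exact (Nat.one_lt_pow (Nat.succ_ne_zero k) hp.out.one_lt).ne' hk
    have hnm : ((commutator F).map π).Normal := Subgroup.Normal.map inferInstance π hsurj
    obtain ⟨z, hz, hzc, hzp⟩ := aux_exists_central hP ((commutator F).map π) hne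
    obtain ⟨s, hs, hsz⟩ := hz
    have hZn : (Subgroup.zpowers z).Normal :=
      aux_normal_of_central _ ((Subgroup.zpowers_le).2 hzc)
    set S := (Subgroup.zpowers z).comap π with hS
    have hSn : S.Normal := Subgroup.Normal.comap hZn π
    have hRS : R ≤ S := by
      intro r hr
      have : π r = 1 := (QuotientGroup.eq_one_iff r).2 hr
      rw [hS, Subgroup.mem_comap, this]
      exact one_mem _
    have hSeq : S = R ⊔ Subgroup.zpowers s := by
      rw [hS, ← hsz, ← MonoidHom.map_zpowers, Subgroup.comap_map_eq, hker, sup_comm]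
    have hsS : s ∈ S := by
      rw [hSeq]; exact le_sup_right (a := R) (Subgroup.mem_zpowers s)
    have hSD : S ≤ R ⊔ commutator F := by
      rw [hSeq]
      exact sup_le_sup_left ((Subgroup.zpowers_le).2 hs) _
    have hsp : s ^ p ∈ R := by
      rw [← hker, MonoidHom.mem_ker, map_pow, hsz, ← hzp, pow_orderOf_eq_one]
    have hidx : R.relIndex S = p := by
      have hk := Subgroup.relIndex_ker S π
      rw [hker, hS, Subgroup.map_comap_eq_self_of_surjective hsurj, Nat.card_zpowers, hzp] at hk
      exact hk
    have hSR : ⁅S, (⊤ : Subgroup F)⁆ ≤ R := by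
      rw [Subgroup.commutator_le]
      intro a ha b _
      rw [← hker, MonoidHom.mem_ker, map_commutatorElement, commutatorElement_eq_one_iff_mul_comm]
      exact (Subgroup.mem_center_iff.1 ((Subgroup.zpowers_le).2 hzc ha) _).symm
    have hstep := aux_step (p := p) X R S s hRS hSeq.le hsS hsp hSR hidx hSD hX
    have hSD' : S ⊔ commutator F = R ⊔ commutator F :=
      le_antisymm (sup_le hSD le_sup_right) (sup_le_sup_right hRS _)
    let q : F ⧸ R →* F ⧸ S := QuotientGroup.map R S (MonoidHom.id F) hRS
    have hq : Function.Surjective q := by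
      intro y
      obtain ⟨y, rfl⟩ := QuotientGroup.mk'_surjective S y
      exact ⟨QuotientGroup.mk' R y, rfl⟩
    have hfin : Finite (F ⧸ S) := Finite.of_surjective q hq
    have hi' := Subgroup.relIndex_mul_relIndex R S (R ⊔ commutator F) hRS hSD
    rw [hidx, hi, pow_succ'] at hi'
    have hi2 := Nat.eq_of_mul_eq_mul_left hp.out.pos hi'
    have hrec := ih S (hP.of_surjective q hq)
      (top_le_iff.1 (hX.symm.le.trans (sup_le_sup_right hRS _))) (by rw [hSD']; exact hi2)
    rw [hSD'] at hrec
    calc _ = ((⁅R, (⊤ : Subgroup F)⁆).relIndex (R ⊓ commutator F) * p) * p ^ k := by ring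
      _ ≤ ((⁅S, (⊤ : Subgroup F)⁆).relIndex (S ⊓ commutator F) * p ^ X.card) * p ^ k :=
        Nat.mul_le_mul_right _ hstep
      _ = ((⁅S, (⊤ : Subgroup F)⁆).relIndex (S ⊓ commutator F) * p ^ k) * p ^ X.card := by ring
      _ ≤ _ := Nat.mul_le_mul_right _ hrec
      _ = _ := by ring

theorem aux_self {F A : Type*} [Group F] [Group A] (α : F →* A) (h : F →* F)
    (hh : α.comp h = α) (x : F) (hx : x ∈ commutator F) :
    x⁻¹ * h x ∈ ⁅α.ker, (⊤ : Subgroup F)⁆ := by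
  set N := ⁅α.ker, (⊤ : Subgroup F)⁆ with hN
  have hr : ∀ y, y⁻¹ * h y ∈ α.ker := by
    intro y
    rw [MonoidHom.mem_ker, map_mul, map_inv]
    have := DFunLike.congr_fun hh y
    simp only [MonoidHom.comp_apply] at this
    rw [this, inv_mul_cancel]
  have hc : ∀ y g : F, (QuotientGroup.mk' N (y⁻¹ * h y)) * QuotientGroup.mk' N g =
      QuotientGroup.mk' N g * QuotientGroup.mk' N (y⁻¹ * h y) := by
    intro y g
    rw [← commutatorElement_eq_one_iff_mul_comm, ← map_commutatorElement]
    exact (QuotientGroup.eq_one_iff _).2 (Subgroup.commutator_mem_commutator (hr y) trivial)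
  let ρ : F →* F ⧸ N := MonoidHom.mk' (fun y => QuotientGroup.mk' N (y⁻¹ * h y)) (by
    intro a b
    have := hc a (b⁻¹)
    calc QuotientGroup.mk' N ((a * b)⁻¹ * h (a * b))
        = QuotientGroup.mk' N b⁻¹ * QuotientGroup.mk' N (a⁻¹ * h a) * QuotientGroup.mk' N (h b) := by
          simp only [← map_mul]; congr 1; simp only [map_mul]; group
      _ = _ := by rw [← this, mul_assoc, ← map_mul])
  have hρ : commutator F ≤ ρ.ker := by
    rw [commutator_def, Subgroup.commutator_le]
    intro a _ b _
    rw [MonoidHom.mem_ker, map_commutatorElement, commutatorElement_eq_one_iff_mul_comm]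
    exact hc a (b⁻¹ * h b)
  exact (QuotientGroup.eq_one_iff _).1 (hρ hx)

theorem aux_map_mem {F₁ F₂ A : Type*} [Group F₁] [Group F₂] [Group A] (α : F₁ →* A) (β : F₂ →* A)
    (f : F₁ →* F₂) (hf : β.comp f = α) :
    (α.ker ⊓ commutator F₁ ≤ (β.ker ⊓ commutator F₂).comap f) ∧
    (⁅α.ker, (⊤ : Subgroup F₁)⁆ ≤ (⁅β.ker, (⊤ : Subgroup F₂)⁆).comap f) := by
  have hk : ∀ x ∈ α.ker, f x ∈ β.ker := by
    intro x hx
    rw [← hf] at hx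
    exact hx
  constructor
  · rintro x ⟨hx, hx'⟩
    refine ⟨hk x hx, ?_⟩
    have : commutator F₁ ≤ (commutator F₂).comap f := by
      rw [commutator_def, Subgroup.commutator_le]
      intro a _ b _
      rw [Subgroup.mem_comap, map_commutatorElement]
      exact Subgroup.commutator_mem_commutator trivial trivial
    exact this hx'
  · rw [Subgroup.commutator_le]
    intro a ha b _
    rw [Subgroup.mem_comap, map_commutatorElement]
    exact Subgroup.commutator_mem_commutator (hk a ha) trivial

theorem aux_indep {F₁ F₂ A : Type*} [Group F₁] [Group F₂] [Group A] (α : F₁ →* A) (β : F₂ →* A)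
    (f : F₁ →* F₂) (g : F₂ →* F₁) (hf : β.comp f = α) (hg : α.comp g = β) :
    hopfCard α = hopfCard β := by
  obtain ⟨f1, f2⟩ := aux_map_mem α β f hf
  obtain ⟨g1, g2⟩ := aux_map_mem β α g hg
  unfold hopfCard
  let φ : (α.ker ⊓ commutator F₁ : Subgroup F₁) →* (β.ker ⊓ commutator F₂ : Subgroup F₂) :=
    (f.comp (Subgroup.subtype _)).codRestrict _ (fun x => f1 x.2)
  let ψ : (β.ker ⊓ commutator F₂ : Subgroup F₂) →* (α.ker ⊓ commutator F₁ : Subgroup F₁) :=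
    (g.comp (Subgroup.subtype _)).codRestrict _ (fun x => g1 x.2)
  let Φ := QuotientGroup.map (⁅α.ker, (⊤ : Subgroup F₁)⁆.subgroupOf (α.ker ⊓ commutator F₁))
    (⁅β.ker, (⊤ : Subgroup F₂)⁆.subgroupOf (β.ker ⊓ commutator F₂)) φ (fun x hx => f2 hx)
  let Ψ := QuotientGroup.map (⁅β.ker, (⊤ : Subgroup F₂)⁆.subgroupOf (β.ker ⊓ commutator F₂))
    (⁅α.ker, (⊤ : Subgroup F₁)⁆.subgroupOf (α.ker ⊓ commutator F₁)) ψ (fun x hx => g2 hx)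
  refine Nat.card_congr ⟨Φ, Ψ, ?_, ?_⟩
  · intro x
    obtain ⟨x, rfl⟩ := QuotientGroup.mk_surjective x
    symm
    refine QuotientGroup.eq.2 ?_
    exact aux_self α (g.comp f) (by rw [← MonoidHom.comp_assoc, hg, hf]) x x.2.2
  · intro x
    obtain ⟨x, rfl⟩ := QuotientGroup.mk_surjective x
    symm
    refine QuotientGroup.eq.2 ?_
    exact aux_self β (f.comp g) (by rw [← MonoidHom.comp_assoc, hf, hg]) x x.2.2

end Aux

/-- For a non-abelian finite `p`-group `G` with `|G'| = p ^ k` and `d = d(G)`, one has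
`|M(G)| · p ^ k ≤ |M(G/G')| · p ^ (k·d)`, where the Schur multipliers are computed via
Hopf's formula from a free presentation. -/
theorem schur_card_mul_le_abelianization
    {p k d : ℕ} (hp : p.Prime) (G : Type*) [Group G] [Finite G]
    (hpG : IsPGroup p G) (hna : ∃ a b : G, a * b ≠ b * a)
    (hk : Nat.card (commutator G) = p ^ k)
    (hd : d = minGens G) :
    schurCard G * p ^ k ≤ schurCard (Abelianization G) * p ^ (k * d) := by
  classical
  have : Fact p.Prime := ⟨hp⟩
  have hne : {n | ∃ S : Finset G, S.card = n ∧ Subgroup.closure (S : Set G) = ⊤}.Nonempty := by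
    have := Fintype.ofFinite G
    exact ⟨_, Finset.univ, rfl, by simp⟩
  obtain ⟨S, hSd, hS⟩ := Nat.sInf_mem hne
  have hSd' : S.card = d := by rw [hd]; exact hSd
  set π : FreeGroup G →* G := FreeGroup.lift (id : G → G) with hπ
  have hsurj : Function.Surjective π := fun g => ⟨FreeGroup.of g, by simp [hπ]⟩
  set X : Finset (FreeGroup G) := S.image FreeGroup.of with hXdef
  have hXc : X.card ≤ d := by rw [← hSd']; exact Finset.card_image_le
  have hX : π.ker ⊔ Subgroup.closure (X : Set (FreeGroup G)) = ⊤ := by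
    have h1 : (Subgroup.closure (X : Set (FreeGroup G))).map π = ⊤ := by
      rw [MonoidHom.map_closure, hXdef, Finset.coe_image, ← Set.image_comp]
      have : (π ∘ FreeGroup.of : G → G) = id := by funext g; simp [hπ]
      rw [this, Set.image_id, hS]
    rw [sup_comm, ← Subgroup.comap_map_eq, h1, Subgroup.comap_top]
  let e := QuotientGroup.quotientKerEquivOfSurjective π hsurj
  have hfin : Finite (FreeGroup G ⧸ π.ker) := Finite.of_equiv _ e.symm.toEquiv
  have hP : IsPGroup p (FreeGroup G ⧸ π.ker) := hpG.of_equiv e.symm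
  have hi : π.ker.relIndex (π.ker ⊔ commutator (FreeGroup G)) = p ^ k := by
    rw [Subgroup.relIndex_sup_left, Subgroup.relIndex_ker, map_commutator_eq,
      MonoidHom.range_eq_top.2 hsurj, ← hk]
    rfl
  have hmain := aux_induct X k π.ker hP hX hi
  have hker : ((Abelianization.of (G := G)).comp π).ker = π.ker ⊔ commutator (FreeGroup G) := by
    rw [← MonoidHom.comap_ker, Abelianization.ker_of, sup_comm, ← Subgroup.comap_map_eq,
      map_commutator_eq, MonoidHom.range_eq_top.2 hsurj]
    rfl
  let f : FreeGroup G →* FreeGroup (Abelianization G) := FreeGroup.map Abelianization.of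
  have hof : Function.Surjective (Abelianization.of (G := G)) := QuotientGroup.mk_surjective
  let g : FreeGroup (Abelianization G) →* FreeGroup G :=
    FreeGroup.lift (fun a => FreeGroup.of (Function.surjInv hof a))
  have hind : hopfCard ((Abelianization.of (G := G)).comp π) = schurCard (Abelianization G) := by
    refine aux_indep _ _ f g ?_ ?_
    · ext x
      simp [f, hπ]
    · ext a
      simp [g, hπ, Function.surjInv_eq]
  have hAb : schurCard (Abelianization G) =
      (⁅π.ker ⊔ commutator (FreeGroup G), (⊤ : Subgroup (FreeGroup G))⁆).relIndex
        ((π.ker ⊔ commutator (FreeGroup G)) ⊓ commutator (FreeGroup G)) := by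
    rw [← hind, ← hker]
    rfl
  rw [hAb]
  refine le_trans hmain (Nat.mul_le_mul_left _ (Nat.pow_le_pow_right hp.pos ?_))
  exact Nat.mul_le_mul_left _ hXc
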